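/- arXiv:math/9906101 — 2 statements merged into one kernel-verified Lean document; each statement's English description precedes it below -/
import Mathlib

section
/- (All cocycles on osp(2|2) are coboundary.) Let δ : G → G⊗G be a linear map on the osp(2|2) Lie superalgebra G such that: (i) for every homogeneous x ∈ G of grade a, δ(x) lies in the sum of the subspaces G_b⊗G_c with b + c ≡ a (mod 2); (ii) δ takes values in graded-antisymmetric tensors, i.e. writing δ(gᵢ) = Σ f_i^{jk} g_j⊗g_k in the basis (g₁,…,g₈) = (H,X₊,X₋,B,V₊,V₋,W₊,W₋), one has f_i^{jk} = −(−1)^{|j||k|} f_i^{kj}; (iii) δ is a 1-cocycle: δ(μ(x,y)) = x·δ(y) − (−1)^{|x||y|} y·δ(x) for all homogeneous x, y ∈ G. Then δ is coboundary: there exists an even, graded-antisymmetric element r ∈ G⊗G such that δ(x) = x·r for all x ∈ G. -/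
noncomputable section

open scoped BigOperators

/-- The underlying vector space of `osp(2|2)`, with coordinates in the basis
`(g₀,…,g₇) = (H, X₊, X₋, B, V₊, V₋, W₊, W₋)`. -/
abbrev G := Fin 8 → ℂ

/-- `G ⊗ G`, represented by coefficient matrices in the basis `gᵢ ⊗ gⱼ`. -/
abbrev TT := Fin 8 → Fin 8 → ℂ

/-- The grade: `H, X₊, X₋, B` are even (0); `V₊, V₋, W₊, W₋` are odd (1). -/
def gr (i : Fin 8) : ℕ := if i.val < 4 then 0 else 1

/-- The sign `z(i,j) = (−1)^{|i||j|}`. -/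
def zz (i j : Fin 8) : ℂ := (-1 : ℂ) ^ (gr i * gr j)

/-- Structure constants of `osp(2|2)` (on `ℕ` indices, 0 outside the table). -/
def cNat : ℕ → ℕ → ℕ → ℂ
  | 0,1,1 => 1 | 1,0,1 => -1
  | 0,2,2 => -1 | 2,0,2 => 1
  | 1,2,0 => -2 | 2,1,0 => 2
  | 0,4,4 => 1/2 | 4,0,4 => -1/2
  | 0,5,5 => -1/2 | 5,0,5 => 1/2
  | 0,6,6 => 1/2 | 6,0,6 => -1/2
  | 0,7,7 => -1/2 | 7,0,7 => 1/2
  | 3,4,4 => 1/2 | 4,3,4 => -1/2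
  | 3,5,5 => 1/2 | 5,3,5 => -1/2
  | 3,6,6 => -1/2 | 6,3,6 => 1/2
  | 3,7,7 => -1/2 | 7,3,7 => 1/2
  | 1,5,4 => -1 | 5,1,4 => 1
  | 2,4,5 => 1 | 4,2,5 => -1
  | 1,7,6 => -1 | 7,1,6 => 1
  | 2,6,7 => 1 | 6,2,7 => -1
  | 4,7,0 => 1 | 4,7,3 => -1 | 7,4,0 => 1 | 7,4,3 => -1
  | 6,5,0 => 1 | 6,5,3 => 1 | 5,6,0 => 1 | 5,6,3 => 1
  | 4,6,1 => 1 | 6,4,1 => 1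
  | 5,7,2 => 1 | 7,5,2 => 1
  | _,_,_ => 0

/-- Structure constants `c i j k`, so that `μ(gᵢ,gⱼ) = Σ_k c i j k • g_k`. -/
def c (i j k : Fin 8) : ℂ := cNat i.val j.val k.val

/-- The bracket `μ` of `osp(2|2)`, extended bilinearly from the basis. -/
def mu (u v : G) : G := fun k => ∑ i, ∑ j, u i * v j * c i j k

/-- The basis vectors `g₀,…,g₇`. -/
def e (i : Fin 8) : G := Pi.single i 1

/-- Membership in the even part `G₀ = span{H, X₊, X₋, B}`. -/
def isEven (v : G) : Prop := ∀ i : Fin 8, 4 ≤ i.val → v i = 0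

/-- Membership in the odd part `G₁ = span{V₊, V₋, W₊, W₋}`. -/
def isOdd (v : G) : Prop := ∀ i : Fin 8, i.val < 4 → v i = 0

/-- The action of the basis vector `gᵢ` on `G ⊗ G`:
`gᵢ·(u⊗v) = μ(gᵢ,u)⊗v + (−1)^{|i||u|} u⊗μ(gᵢ,v)`. -/
def actB (i : Fin 8) (r : TT) : TT :=
  fun p q => (∑ j, c i j p * r j q) + zz i p * ∑ j, c i j q * r p j

/-- The (bilinearly extended) action `x ↦ x·r` of `G` on `G ⊗ G`, as a linear map in `x`. -/
def actL (r : TT) : G →ₗ[ℂ] TT :=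
  ∑ i : Fin 8, LinearMap.smulRight (LinearMap.proj i : G →ₗ[ℂ] ℂ) (actB i r)

/-- Twice the `H`-weight of the basis vectors. -/
def hw : Fin 8 → ℤ := ![0, 2, -2, 0, 1, -1, 1, -1]

/-- Twice the `B`-weight of the basis vectors. -/
def bw : Fin 8 → ℤ := ![0, 0, 0, 0, 1, 1, -1, -1]

/-- A multiple of a basis vector. -/
def cell (v : ℂ) (k : Fin 8) : Fin 8 → ℂ := fun l => if l = k then v else 0

/-- The multiplication table of `osp(2|2)`. -/
def tbl : Fin 8 → Fin 8 → Fin 8 → ℂ :=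
  ![![0, cell (1) 1, cell (-1) 2, 0, cell (1/2) 4, cell (-1/2) 5, cell (1/2) 6, cell (-1/2) 7],
    ![cell (-1) 1, 0, cell (-2) 0, 0, 0, cell (-1) 4, 0, cell (-1) 6],
    ![cell (1) 2, cell (2) 0, 0, 0, cell (1) 5, 0, cell (1) 7, 0],
    ![0, 0, 0, 0, cell (1/2) 4, cell (1/2) 5, cell (-1/2) 6, cell (-1/2) 7],
    ![cell (-1/2) 4, 0, cell (-1) 5, cell (-1/2) 4, 0, 0, cell (1) 1, fun l => if l = 0 then 1 else cell (-1) 3 l],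
    ![cell (1/2) 5, cell (1) 4, 0, cell (-1/2) 5, 0, 0, fun l => if l = 0 then 1 else cell (1) 3 l, cell (1) 2],
    ![cell (-1/2) 6, 0, cell (-1) 7, cell (1/2) 6, cell (1) 1, fun l => if l = 0 then 1 else cell (1) 3 l, 0, 0],
    ![cell (1/2) 7, cell (1) 6, 0, cell (1/2) 7, fun l => if l = 0 then 1 else cell (-1) 3 l, cell (1) 2, 0, 0]]

set_option maxHeartbeats 4000000 in
lemma c_tbl (i j k : Fin 8) : c i j k = tbl i j k := by
  fin_cases i <;> fin_cases j <;> fin_cases k <;> rfl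

set_option maxHeartbeats 4000000 in
lemma c_weight (i j k : Fin 8) : c i j k = 0 ∨ (hw i + hw j = hw k ∧ bw i + bw j = bw k) := by
  fin_cases i <;> fin_cases j <;> fin_cases k <;>
    first
    | exact Or.inr (by decide)
    | exact Or.inl rfl

set_option maxHeartbeats 4000000 in
lemma c_H (i k : Fin 8) : c 0 i k = if i = k then (hw i : ℂ) / 2 else 0 := by
  fin_cases i <;> fin_cases k <;> simp [c_tbl, tbl, cell, hw]

set_option maxHeartbeats 4000000 in
lemma c_B (i k : Fin 8) : c 3 i k = if i = k then (bw i : ℂ) / 2 else 0 := by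
  fin_cases i <;> fin_cases k <;> simp [c_tbl, tbl, cell, bw]

lemma actL_e (r : TT) (i : Fin 8) : actL r (e i) = actB i r := by
  simp [actL, e, Pi.single_apply]

lemma mu_e (i j : Fin 8) : mu (e i) (e j) = fun k => c i j k := by
  funext k
  simp [mu, e, Pi.single_apply]

lemma sum_e (x : G) : x = ∑ k, x k • e k := by
  funext k
  simp [e, Pi.single_apply]

lemma even_e (i : Fin 8) (h : i.val < 4) : isEven (e i) := by
  intro j hj
  have : j ≠ i := by rintro rfl; omega
  simp [e, this]

lemma odd_e (i : Fin 8) (h : 4 ≤ i.val) : isOdd (e i) := by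
  intro j hj
  have : j ≠ i := by rintro rfl; omega
  simp [e, this]

/-- The action only sees coefficients of the appropriate weight. -/
lemma actB_congr (i p q : Fin 8) (r s : TT) (a : ℂ)
    (h : ∀ j k, hw j + hw k + hw i = hw p + hw q → bw j + bw k + bw i = bw p + bw q →
      r j k = a * s j k) :
    actB i r p q = a * actB i s p q := by
  have h1 : ∀ j, c i j p * r j q = a * (c i j p * s j q) := by
    intro j
    rcases c_weight i j p with h0 | ⟨h1, h2⟩
    · simp [h0]
    · rw [h j q (by linarith) (by linarith)]; ring
  have h2 : ∀ j, c i j q * r p j = a * (c i j q * s p j) := by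
    intro j
    rcases c_weight i j q with h0 | ⟨h1, h2⟩
    · simp [h0]
    · rw [h p j (by linarith) (by linarith)]; ring
  simp only [actB, h1, h2, ← Finset.mul_sum]
  ring

/-- The weight zero part of the solution. -/
def r0 (a b s t : ℂ) (p q : Fin 8) : ℂ :=
  match p.val, q.val with
  | 0, 3 => a | 3, 0 => -a
  | 1, 2 => b | 2, 1 => -b
  | 4, 7 => s | 7, 4 => s
  | 5, 6 => t | 6, 5 => t
  | _, _ => 0

set_option maxHeartbeats 4000000 in
lemma r0_even (a b s t : ℂ) (p q : Fin 8) (h : gr p ≠ gr q) : r0 a b s t p q = 0 := by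
  fin_cases p <;> fin_cases q <;> first | rfl | (exact absurd rfl h)

set_option maxHeartbeats 4000000 in
lemma r0_anti (a b s t : ℂ) (p q : Fin 8) : r0 a b s t p q = - zz p q * r0 a b s t q p := by
  fin_cases p <;> fin_cases q <;> simp [r0, zz, gr]

lemma zz_H (p : Fin 8) : zz 0 p = 1 := by
  simp [zz, gr]

lemma zz_B (p : Fin 8) : zz 3 p = 1 := by
  simp [zz, gr]

set_option maxHeartbeats 4000000 in
lemma weight_zero_cases : ∀ i p q : Fin 8, hw p + hw q = hw i → bw p + bw q = bw i →
    (i, p, q) ∈ ([(0, 0, 0), (0, 0, 3), (0, 1, 2), (0, 2, 1), (0, 3, 0), (0, 3, 3), (0, 4, 7), (0, 5, 6),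
      (0, 6, 5), (0, 7, 4), (1, 0, 1), (1, 1, 0), (1, 1, 3), (1, 3, 1), (1, 4, 6), (1, 6, 4),
      (2, 0, 2), (2, 2, 0), (2, 2, 3), (2, 3, 2), (2, 5, 7), (2, 7, 5), (3, 0, 0), (3, 0, 3),
      (3, 1, 2), (3, 2, 1), (3, 3, 0), (3, 3, 3), (3, 4, 7), (3, 5, 6), (3, 6, 5), (3, 7, 4),
      (4, 0, 4), (4, 1, 5), (4, 3, 4), (4, 4, 0), (4, 4, 3), (4, 5, 1), (5, 0, 5), (5, 2, 4),
      (5, 3, 5), (5, 4, 2), (5, 5, 0), (5, 5, 3), (6, 0, 6), (6, 1, 7), (6, 3, 6), (6, 6, 0),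
      (6, 6, 3), (6, 7, 1), (7, 0, 7), (7, 2, 6), (7, 3, 7), (7, 6, 2), (7, 7, 0), (7, 7, 3)] : List (Fin 8 × Fin 8 × Fin 8)) := by
  decide

set_option maxHeartbeats 4000000 in
/-- The weight zero sector, in coordinates. -/
lemma zero_sector (f : Fin 8 → TT)
    (han : ∀ i j k, f i j k = - zz j k * f i k j)
    (hc : ∀ i j p q, ∑ k, c i j k * f k p q
      = actB i (f j) p q - zz i j * actB j (f i) p q)
    (i p q : Fin 8) (h1 : hw p + hw q = hw i) (h2 : bw p + bw q = bw i) :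
    f i p q = actB i (r0 (-f 1 1 3) (f 1 0 1 / 2) (f 6 1 7 + f 1 0 1 / 2)
      (f 4 1 5 + f 1 0 1 / 2)) p q := by
  have a000 : f 0 0 0 = 0 := by
    have h := han 0 0 0
    simp only [zz, gr] at h
    norm_num at h
    linear_combination h / 2
  have a003 := han 0 3 0
  have a012 := han 0 2 1
  have a033 : f 0 3 3 = 0 := by
    have h := han 0 3 3
    simp only [zz, gr] at h
    norm_num at h
    linear_combination h / 2
  have a047 := han 0 7 4
  have a056 := han 0 6 5
  have a101 := han 1 1 0
  have a113 := han 1 3 1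
  have a146 := han 1 6 4
  have a202 := han 2 2 0
  have a223 := han 2 3 2
  have a257 := han 2 7 5
  have a300 : f 3 0 0 = 0 := by
    have h := han 3 0 0
    simp only [zz, gr] at h
    norm_num at h
    linear_combination h / 2
  have a303 := han 3 3 0
  have a312 := han 3 2 1
  have a333 : f 3 3 3 = 0 := by
    have h := han 3 3 3
    simp only [zz, gr] at h
    norm_num at h
    linear_combination h / 2
  have a347 := han 3 7 4
  have a356 := han 3 6 5
  have a404 := han 4 4 0
  have a415 := han 4 5 1
  have a434 := han 4 4 3
  have a505 := han 5 5 0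
  have a524 := han 5 4 2
  have a535 := han 5 5 3
  have a606 := han 6 6 0
  have a617 := han 6 7 1
  have a636 := han 6 6 3
  have a707 := han 7 7 0
  have a726 := han 7 6 2
  have a737 := han 7 7 3
  simp [zz, gr] at a003 a012 a047 a056 a101 a113 a146 a202 a223 a257 a303 a312 a347 a356 a404 a415 a434 a505 a524 a535 a606 a617 a636 a707 a726 a737
  have h0101 := hc 0 1 0 1
  have h0113 := hc 0 1 1 3
  have h1301 := hc 1 3 0 1
  have h1313 := hc 1 3 1 3
  have h0146 := hc 0 1 4 6
  have h0404 := hc 0 4 0 4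
  have h1346 := hc 1 3 4 6
  have h3404 := hc 3 4 0 4
  have h4444 := hc 4 4 4 4
  have h5555 := hc 5 5 5 5
  have h6666 := hc 6 6 6 6
  have h7777 := hc 7 7 7 7
  have h1203 := hc 1 2 0 3
  have h1212 := hc 1 2 1 2
  have h1247 := hc 1 2 4 7
  have h1515 := hc 1 5 1 5
  have h1534 := hc 1 5 3 4
  have h1717 := hc 1 7 1 7
  have h1736 := hc 1 7 3 6
  have h2424 := hc 2 4 2 4
  have h2626 := hc 2 6 2 6
  have h4712 := hc 4 7 1 2
  simp [actB, Fin.sum_univ_eight, c_tbl, tbl, cell, zz, gr, a003, a012, a047, a056, a101, a113, a146, a202, a223, a257, a303, a312, a347, a356, a404, a415, a434, a505, a524, a535, a606, a617, a636, a707, a726, a737, a000, a033, a300, a333] at h0101 h0113 h1301 h1313 h0146 h0404 h1346 h3404 h4444 h5555 h6666 h7777 h1203 h1212 h1247 h1515 h1534 h1717 h1736 h2424 h2626 h4712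
  have v003 : f 0 0 3 = 0 := by
    linear_combination (1) * h0113
  have v012 : f 0 1 2 = 0 := by
    linear_combination (1/2) * h0101
  have v047 : f 0 4 7 = 0 := by
    linear_combination (1) * h0404 + (1/2) * h0113
  have v056 : f 0 5 6 = 0 := by
    linear_combination (-1) * h0146 + (-1) * h0404 + (-1/2) * h0113
  have v146 : f 1 4 6 = (-1) * f 1 0 1 + (-1) * f 4 1 5 + (-1) * f 6 1 7 := by
    linear_combination (-1) * h1736 + (-1/2) * h1212 + (-1/4) * h1203 + (-1/2) * h0113 + (1) * h2626 + (1/2) * h6666 + (-1) * h4712 + (-1) * h1301 + (-1) * h1717 + (-1/2) * h7777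
  have v202 : f 2 0 2 = (1) * f 1 0 1 := by
    linear_combination (1) * h1212 + (1) * h0101
  have v223 : f 2 2 3 = (-1) * f 1 1 3 := by
    linear_combination (1/2) * h1203 + (1) * h0113
  have v257 : f 2 5 7 = (1) * f 1 0 1 + (1) * f 4 1 5 + (1) * f 6 1 7 := by
    linear_combination (2) * h0404 + (3/2) * h0113 + (1) * h1247 + (1) * h1736 + (1/2) * h1212 + (1/4) * h1203 + (-1) * h2626 + (-1/2) * h6666 + (1) * h4712 + (1) * h1301 + (1) * h1717 + (1/2) * h7777
  have v303 : f 3 0 3 = 0 := by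
    linear_combination (1) * h1313
  have v312 : f 3 1 2 = 0 := by
    linear_combination (1) * h1301
  have v347 : f 3 4 7 = 0 := by
    linear_combination (1) * h3404 + (1/2) * h1313
  have v356 : f 3 5 6 = 0 := by
    linear_combination (-1) * h3404 + (-1/2) * h1313 + (1) * h1346
  have v404 : f 4 0 4 = (1/2) * f 1 1 3 + (1) * f 6 1 7 + (1/2) * f 1 0 1 := by
    linear_combination (1/2) * h4444 + (1) * h1736 + (1) * h1534 + (-1) * h1515 + (-1/2) * h5555 + (1/2) * h1212 + (1/4) * h1203 + (1/2) * h0113 + (-1) * h2626 + (-1/2) * h6666 + (1) * h4712 + (1) * h1301 + (1) * h1717 + (1/2) * h7777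
  have v434 : f 4 3 4 = (-1/2) * f 1 1 3 + (-1) * f 6 1 7 + (-1/2) * f 1 0 1 := by
    linear_combination (-1) * h1736 + (-1) * h1534 + (1) * h1515 + (1/2) * h5555 + (-1/2) * h1212 + (-1/4) * h1203 + (-1/2) * h0113 + (1) * h2626 + (1/2) * h6666 + (-1) * h4712 + (-1) * h1301 + (-1) * h1717 + (-1/2) * h7777
  have v505 : f 5 0 5 = (1) * f 4 1 5 + (1/2) * f 1 0 1 + (1/2) * f 1 1 3 := by
    linear_combination (1) * h1515
  have v524 : f 5 2 4 = (1) * f 6 1 7 := by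
    linear_combination (-1) * h2626 + (1) * h2424 + (1/2) * h1203 + (1) * h0113 + (1/2) * h4444 + (1) * h1736 + (1) * h1534 + (-1) * h1515 + (-1/2) * h5555 + (-1/2) * h6666 + (1) * h4712 + (-1/2) * h0101 + (1) * h1301 + (1) * h1717 + (1/2) * h7777
  have v535 : f 5 3 5 = (1) * f 4 1 5 + (1/2) * f 1 0 1 + (1/2) * f 1 1 3 := by
    linear_combination (1) * h1515 + (1/2) * h5555
  have v606 : f 6 0 6 = (1/2) * f 1 0 1 + (-1/2) * f 1 1 3 + (1) * f 4 1 5 := by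
    linear_combination (1/2) * h1212 + (1/4) * h1203 + (1/2) * h0113 + (-1) * h2626 + (1) * h4712 + (1) * h1301
  have v636 : f 6 3 6 = (1/2) * f 1 0 1 + (-1/2) * f 1 1 3 + (1) * f 4 1 5 := by
    linear_combination (1/2) * h1212 + (1/4) * h1203 + (1/2) * h0113 + (-1) * h2626 + (-1/2) * h6666 + (1) * h4712 + (1) * h1301
  have v707 : f 7 0 7 = (1) * f 6 1 7 + (1/2) * f 1 0 1 + (-1/2) * f 1 1 3 := by
    linear_combination (1) * h1717
  have v726 : f 7 2 6 = (1) * f 4 1 5 := by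
    linear_combination (1) * h4712 + (-1/2) * h0101 + (1) * h1301
  have v737 : f 7 3 7 = (-1) * f 6 1 7 + (-1/2) * f 1 0 1 + (1/2) * f 1 1 3 := by
    linear_combination (-1) * h1717 + (-1/2) * h7777
  have hm := weight_zero_cases i p q h1 h2
  clear h1 h2 hc
  simp only [List.mem_cons, Prod.mk.injEq, List.not_mem_nil, or_false] at hm
  rcases hm with ⟨rfl, rfl, rfl⟩ | ⟨rfl, rfl, rfl⟩ | ⟨rfl, rfl, rfl⟩ | ⟨rfl, rfl, rfl⟩ | ⟨rfl, rfl, rfl⟩ | ⟨rfl, rfl, rfl⟩ | ⟨rfl, rfl, rfl⟩ | ⟨rfl, rfl, rfl⟩ | ⟨rfl, rfl, rfl⟩ | ⟨rfl, rfl, rfl⟩ | ⟨rfl, rfl, rfl⟩ | ⟨rfl, rfl, rfl⟩ | ⟨rfl, rfl, rfl⟩ | ⟨rfl, rfl, rfl⟩ | ⟨rfl, rfl, rfl⟩ | ⟨rfl, rfl, rfl⟩ | ⟨rfl, rfl, rfl⟩ | ⟨rfl, rfl, rfl⟩ | ⟨rfl, rfl, rfl⟩ | ⟨rfl, rfl,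 rfl⟩ | ⟨rfl, rfl, rfl⟩ | ⟨rfl, rfl, rfl⟩ | ⟨rfl, rfl, rfl⟩ | ⟨rfl, rfl, rfl⟩ | ⟨rfl, rfl, rfl⟩ | ⟨rfl, rfl, rfl⟩ | ⟨rfl, rfl, rfl⟩ | ⟨rfl, rfl, rfl⟩ | ⟨rfl, rfl, rfl⟩ | ⟨rfl, rfl, rfl⟩ | ⟨rfl, rfl, rfl⟩ | ⟨rfl, rfl, rfl⟩ | ⟨rfl, rfl, rfl⟩ | ⟨rfl, rfl, rfl⟩ | ⟨rfl, rfl, rfl⟩ | ⟨rfl, rfl, rfl⟩ | ⟨rfl, rfl, rfl⟩ | ⟨rfl, rfl, rfl⟩ | ⟨rfl, rfl, rfl⟩ | ⟨rfl, rfl, rfl⟩ | ⟨rfl, rfl, rfl⟩ | ⟨rfl, rfl, rfl⟩ | ⟨rfl, rfl, rfl⟩ | ⟨rfl, rfl, rfl⟩ | ⟨rfl, rfl, rfl⟩ | ⟨rfl, rfl, rfl⟩ | ⟨rfl, rfl, rfl⟩ | ⟨rfl, rfl, rfl⟩ | ⟨rfl, rfl, rfl⟩ | ⟨rfl, rfl,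 rfl⟩ | ⟨rfl, rfl, rfl⟩ | ⟨rfl, rfl, rfl⟩ | ⟨rfl, rfl, rfl⟩ | ⟨rfl, rfl, rfl⟩ | ⟨rfl, rfl, rfl⟩ | ⟨rfl, rfl, rfl⟩ <;>
    simp [actB, Fin.sum_univ_eight, c_tbl, tbl, cell, zz, gr, r0, a003, a012, a047, a056, a101, a113, a146, a202, a223, a257, a303, a312, a347, a356, a404, a415, a434, a505, a524, a535, a606, a617, a636, a707, a726, a737, a000, a033, a300, a333, v003, v012, v047, v056, v146, v202, v223, v257, v303, v312, v347, v356, v404, v434, v505, v524, v535, v606, v636, v707, v726, v737] <;> ring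

/-- every parity-respecting, graded-antisymmetric 1-cocycle
`δ : G → G⊗G` on `osp(2|2)` is a coboundary `δ(x) = x·r` for some even,
graded-antisymmetric `r ∈ G⊗G`. -/
theorem stmt7 (δ : G →ₗ[ℂ] TT)
    (hpar0 : ∀ x, isEven x → ∀ p q : Fin 8, (gr p + gr q) % 2 = 1 → δ x p q = 0)
    (hpar1 : ∀ x, isOdd x → ∀ p q : Fin 8, (gr p + gr q) % 2 = 0 → δ x p q = 0)
    (hanti : ∀ i j k : Fin 8, δ (e i) j k = - zz j k * δ (e i) k j)
    (hcoc1 : ∀ x y, (isEven x ∨ isEven y) → δ (mu x y) = actL (δ y) x - actL (δ x) y)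
    (hcoc2 : ∀ x y, isOdd x → isOdd y → δ (mu x y) = actL (δ y) x + actL (δ x) y) :
    ∃ r : TT, (∀ p q : Fin 8, gr p ≠ gr q → r p q = 0) ∧
      (∀ p q : Fin 8, r p q = - zz p q * r q p) ∧
      ∀ x : G, δ x = actL r x := by
  set f : Fin 8 → TT := fun i => δ (e i) with hf
  have hc : ∀ i j p q, ∑ k, c i j k * f k p q
      = actB i (f j) p q - zz i j * actB j (f i) p q := by
    intro i j p q
    have hL : δ (mu (e i) (e j)) p q = ∑ k, c i j k * f k p q := by
      rw [mu_e, sum_e (fun k => c i j k), map_sum]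
      simp [hf, Finset.sum_apply]
    rw [← hL]
    by_cases hi : i.val < 4
    · rw [hcoc1 _ _ (Or.inl (even_e i hi)), actL_e, actL_e]
      simp [zz, gr, hi, hf]
    · by_cases hj : j.val < 4
      · rw [hcoc1 _ _ (Or.inr (even_e j hj)), actL_e, actL_e]
        simp [zz, gr, hj, hf]
      · rw [hcoc2 _ _ (odd_e i (by omega)) (odd_e j (by omega)), actL_e, actL_e]
        simp [zz, gr, hi, hj, hf]
  have hH : ∀ i p q, ((hw p + hw q - hw i : ℤ) : ℂ) / 2 * f i p q = actB i (f 0) p q := by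
    intro i p q
    have h := hc 0 i p q
    simp only [actB, c_H, ite_mul, zero_mul, Finset.sum_ite_eq, Finset.sum_ite_eq',
      Finset.mem_univ, if_true] at h ⊢
    simp only [zz_H, one_mul] at h
    push_cast
    linear_combination -h
  have hB : ∀ i p q, ((bw p + bw q - bw i : ℤ) : ℂ) / 2 * f i p q = actB i (f 3) p q := by
    intro i p q
    have h := hc 3 i p q
    simp only [actB, c_B, ite_mul, zero_mul, Finset.sum_ite_eq, Finset.sum_ite_eq',
      Finset.mem_univ, if_true] at h ⊢
    simp only [zz_B, one_mul] at h
    push_cast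
    linear_combination -h
  have hev : ∀ i : Fin 8, i.val < 4 → ∀ p q, gr p ≠ gr q → f i p q = 0 := by
    intro i hi p q hpq
    refine hpar0 _ (even_e i hi) p q ?_
    revert hpq
    simp only [gr]
    split_ifs <;> simp
  let ρ : TT := r0 (-f 1 1 3) (f 1 0 1 / 2) (f 6 1 7 + f 1 0 1 / 2) (f 4 1 5 + f 1 0 1 / 2)
  let r : TT := fun p q =>
    if hw p + hw q ≠ 0 then 2 / ((hw p + hw q : ℤ) : ℂ) * f 0 p q
    else if bw p + bw q ≠ 0 then 2 / ((bw p + bw q : ℤ) : ℂ) * f 3 p q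
    else ρ p q
  refine ⟨r, ?_, ?_, ?_⟩
  · intro p q hpq
    simp only [r, ρ, hev 0 (by decide) p q hpq, hev 3 (by decide) p q hpq, r0_even _ _ _ _ p q hpq]
    simp
  · intro p q
    simp only [r, ρ]
    rw [add_comm (hw q), add_comm (bw q)]
    split_ifs
    · rw [show f 0 p q = _ from hanti 0 p q]; simp only [hf]; ring
    · rw [show f 3 p q = _ from hanti 3 p q]; simp only [hf]; ring
    · exact r0_anti _ _ _ _ p q
  · have key : ∀ i, f i = actB i r := by
      intro i
      funext p q
      by_cases h1 : hw p + hw q - hw i = 0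
      · by_cases h2 : bw p + bw q - bw i = 0
        · rw [zero_sector f hanti hc i p q (by linarith) (by linarith),
            actB_congr i p q r ρ 1, one_mul]
          intro j k hj hk
          have h3 : hw j + hw k = 0 := by linarith
          have h4 : bw j + bw k = 0 := by linarith
          simp [r, h3, h4]
        · have h5 : ((bw p + bw q - bw i : ℤ) : ℂ) ≠ 0 := by exact_mod_cast h2
          rw [actB_congr i p q r (f 3) (2 / ((bw p + bw q - bw i : ℤ) : ℂ)), ← hB]
          · field_simp
          · intro j k hj hk
            have h3 : hw j + hw k = 0 := by linarith
            have h4 : bw j + bw k = bw p + bw q - bw i := by linarith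
            simp only [r, h3, h4]
            simp only [ne_eq, not_true_eq_false, if_false, h2, not_false_eq_true, if_true]
      · have h5 : ((hw p + hw q - hw i : ℤ) : ℂ) ≠ 0 := by exact_mod_cast h1
        rw [actB_congr i p q r (f 0) (2 / ((hw p + hw q - hw i : ℤ) : ℂ)), ← hH]
        · field_simp
        · intro j k hj hk
          have h3 : hw j + hw k = hw p + hw q - hw i := by linarith
          simp only [r, h3]
          simp only [ne_eq, h1, not_false_eq_true, if_true]
    intro x
    rw [sum_e x, map_sum, map_sum]
    refine Finset.sum_congr rfl fun k _ => ?_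
    rw [map_smul, map_smul, actL_e, ← key k]

end
end

section
/- For all nonzero complex numbers Z, M, U, consider r = −2Z H∧X₋ + M X₊∧X₋ − (MU/(2Z)) V₊∧V₊ + U V₊∧V₋ − (UZ/(2M)) V₋∧V₋ + M V₋∧W₊ − Z V₋∧W₋ − (MZ/(2U)) W₋∧W₋ in G⊗G for the osp(2|2) Lie superalgebra G. Then there exists an even automorphism A of G such that (A⊗A)(r) = −M(X₊∧X₋ + V₊∧W₋ + ½V₋∧V₋ + ½W₊∧W₊), where A⊗A acts on G⊗G factorwise. -/
noncomputable section

open scoped BigOperators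

/-- An even automorphism of `osp(2|2)`: a bijective linear map preserving the
grading and the bracket. -/
def IsEvenAut (A : G →ₗ[ℂ] G) : Prop :=
  Function.Bijective A ∧ (∀ v, isEven v → isEven (A v)) ∧
    (∀ v, isOdd v → isOdd (A v)) ∧ ∀ x y, A (mu x y) = mu (A x) (A y)

/-- The graded wedge `gᵢ ∧ gⱼ = gᵢ⊗gⱼ − (−1)^{|i||j|} gⱼ⊗gᵢ` as an element of `G ⊗ G`. -/
def wdg (i j : Fin 8) : TT :=
  fun p q => (if p = i ∧ q = j then (1 : ℂ) else 0)
    - zz i j * (if p = j ∧ q = i then (1 : ℂ) else 0)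

/-- The factorwise action `A ⊗ A` on `G ⊗ G`. -/
def mapT (A : G →ₗ[ℂ] G) (s : TT) : TT :=
  fun p q => ∑ i, ∑ j, s i j * A (e i) p * A (e j) q

/-- The automorphism, with parameters `k = Z / M`, `t ^ 2 = Z / U`, `s = 1 / t`. -/
def autA (k s t : ℂ) : G →ₗ[ℂ] G where
  toFun v := ![-v 0 - 2 * k * v 1, k * v 0 + k ^ 2 * v 1 + v 2, v 1, v 3,
    -(t * k) * v 4 - t * v 5, t * v 4, -(s * k) * v 6 - s * v 7, s * v 6]
  map_add' u v := by
    ext i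
    fin_cases i <;> simp <;> ring
  map_smul' a v := by
    ext i
    fin_cases i <;> simp <;> ring

theorem autA_apply (k s t : ℂ) (v : G) : autA k s t v =
    ![-v 0 - 2 * k * v 1, k * v 0 + k ^ 2 * v 1 + v 2, v 1, v 3,
    -(t * k) * v 4 - t * v 5, t * v 4, -(s * k) * v 6 - s * v 7, s * v 6] := rfl

set_option maxHeartbeats 4000000 in
theorem mu_eq (u v : G) : mu u v =
    ![-2 * u 1 * v 2 + 2 * u 2 * v 1 + u 4 * v 7 + u 7 * v 4 + u 6 * v 5 + u 5 * v 6,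
      u 0 * v 1 - u 1 * v 0 + u 4 * v 6 + u 6 * v 4,
      -u 0 * v 2 + u 2 * v 0 + u 5 * v 7 + u 7 * v 5,
      -u 4 * v 7 - u 7 * v 4 + u 6 * v 5 + u 5 * v 6,
      (u 0 * v 4 - u 4 * v 0 + u 3 * v 4 - u 4 * v 3) / 2 - u 1 * v 5 + u 5 * v 1,
      (-u 0 * v 5 + u 5 * v 0 + u 3 * v 5 - u 5 * v 3) / 2 + u 2 * v 4 - u 4 * v 2,
      (u 0 * v 6 - u 6 * v 0 - u 3 * v 6 + u 6 * v 3) / 2 - u 1 * v 7 + u 7 * v 1,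
      (-u 0 * v 7 + u 7 * v 0 - u 3 * v 7 + u 7 * v 3) / 2 + u 2 * v 6 - u 6 * v 2] := by
  ext i
  fin_cases i <;> simp [mu, Fin.sum_univ_eight, c, cNat] <;> ring

theorem autA_mu (k s t : ℂ) (h : s * t = 1) (x y : G) :
    autA k s t (mu x y) = mu (autA k s t x) (autA k s t y) := by
  rw [mu_eq, mu_eq, autA_apply, autA_apply, autA_apply]
  ext i
  fin_cases i <;> simp <;> grind

theorem autA_inj (k s t : ℂ) (h : s * t = 1) : Function.Injective (autA k s t) := by
  have hs : s ≠ 0 := left_ne_zero_of_mul_eq_one h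
  have ht : t ≠ 0 := right_ne_zero_of_mul_eq_one h
  rw [← LinearMap.ker_eq_bot, LinearMap.ker_eq_bot']
  intro v hv
  rw [autA_apply] at hv
  have h0 := congrFun hv 0
  have h1 := congrFun hv 1
  have h2 := congrFun hv 2
  have h3 := congrFun hv 3
  have h4 := congrFun hv 4
  have h5 := congrFun hv 5
  have h6 := congrFun hv 6
  have h7 := congrFun hv 7
  simp at h0 h1 h2 h3 h4 h5 h6 h7
  ext i
  fin_cases i <;> simp <;> grind

theorem autA_isEvenAut (k s t : ℂ) (h : s * t = 1) : IsEvenAut (autA k s t) := by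
  have hi := autA_inj k s t h
  refine ⟨⟨hi, LinearMap.injective_iff_surjective.mp hi⟩, ?_, ?_, autA_mu k s t h⟩
  · intro v hv i hi
    have h4 := hv 4 (by decide)
    have h5 := hv 5 (by decide)
    have h6 := hv 6 (by decide)
    have h7 := hv 7 (by decide)
    rw [autA_apply]
    fin_cases i <;> simp_all
  · intro v hv i hi
    have h0 := hv 0 (by decide)
    have h1 := hv 1 (by decide)
    have h2 := hv 2 (by decide)
    have h3 := hv 3 (by decide)
    rw [autA_apply]
    fin_cases i <;> simp_all

theorem mapT_add (A : G →ₗ[ℂ] G) (r s : TT) : mapT A (r + s) = mapT A r + mapT A s := by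
  ext p q
  simp [mapT, add_mul, Finset.sum_add_distrib]

theorem mapT_smul (A : G →ₗ[ℂ] G) (a : ℂ) (s : TT) : mapT A (a • s) = a • mapT A s := by
  ext p q
  simp [mapT, mul_assoc, Finset.mul_sum]

theorem mapT_wdg (A : G →ₗ[ℂ] G) (i j : Fin 8) : mapT A (wdg i j) =
    fun p q => A (e i) p * A (e j) q - zz i j * (A (e j) p * A (e i) q) := by
  ext p q
  simp [mapT, wdg, sub_mul, Finset.sum_sub_distrib, ite_and, mul_assoc]

theorem autA_mapT (M k s t : ℂ) (h : s * t = 1) :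
    mapT (autA k s t) ((-2 * (M * k)) • wdg 0 2 + M • wdg 1 2 + (-(M * s ^ 2 / 2)) • wdg 4 4
          + (M * k * s ^ 2) • wdg 4 5 + (-(M * k ^ 2 * s ^ 2 / 2)) • wdg 5 5 + M • wdg 5 6
          + (-(M * k)) • wdg 5 7 + (-(M * t ^ 2 / 2)) • wdg 7 7)
        = (-M) • (wdg 1 2 + wdg 4 7 + (1/2 : ℂ) • wdg 5 5 + (1/2 : ℂ) • wdg 6 6) := by
  have hz02 : zz 0 2 = 1 := by simp [zz, gr]
  have hz12 : zz 1 2 = 1 := by simp [zz, gr]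
  have hz : ∀ i j : Fin 8, 4 ≤ i.val → 4 ≤ j.val → zz i j = -1 := by
    intro i j hi hj
    simp [zz, gr, not_lt.mpr hi, not_lt.mpr hj]
  have e0 : autA k s t (e 0) = ![-1, k, 0, 0, 0, 0, 0, 0] := by
    rw [autA_apply]; simp [e]
  have e1 : autA k s t (e 1) = ![-2 * k, k ^ 2, 1, 0, 0, 0, 0, 0] := by
    rw [autA_apply]; simp [e]
  have e2 : autA k s t (e 2) = ![0, 1, 0, 0, 0, 0, 0, 0] := by
    rw [autA_apply]; simp [e]
  have e4 : autA k s t (e 4) = ![0, 0, 0, 0, -(t * k), t, 0, 0] := by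
    rw [autA_apply]; simp [e]
  have e5 : autA k s t (e 5) = ![0, 0, 0, 0, -t, 0, 0, 0] := by
    rw [autA_apply]; simp [e]
  have e6 : autA k s t (e 6) = ![0, 0, 0, 0, 0, 0, -(s * k), s] := by
    rw [autA_apply]; simp [e]
  have e7 : autA k s t (e 7) = ![0, 0, 0, 0, 0, 0, -s, 0] := by
    rw [autA_apply]; simp [e]
  simp only [mapT_add, mapT_smul, mapT_wdg, e0, e1, e2, e4, e5, e6, e7, hz02, hz12,
    hz 4 4 (by decide) (by decide), hz 4 5 (by decide) (by decide),
    hz 5 5 (by decide) (by decide), hz 5 6 (by decide) (by decide),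
    hz 5 7 (by decide) (by decide), hz 7 7 (by decide) (by decide)]
  ext p q
  simp only [Pi.add_apply, Pi.smul_apply, smul_eq_mul, wdg, hz12,
    hz 4 7 (by decide) (by decide), hz 5 5 (by decide) (by decide),
    hz 6 6 (by decide) (by decide)]
  fin_cases p <;> fin_cases q <;> simp <;> grind

/-- Case 6: the generic computer solution is equivalent, by an even
automorphism, to `−M(X₊∧X₋ + V₊∧W₋ + ½V₋∧V₋ + ½W₊∧W₊)`. -/
theorem stmt15 (Z M U : ℂ) (hZ : Z ≠ 0) (hM : M ≠ 0) (hU : U ≠ 0) :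
    ∃ A : G →ₗ[ℂ] G, IsEvenAut A ∧
      mapT A ((-2 * Z) • wdg 0 2 + M • wdg 1 2 + (-(M * U / (2 * Z))) • wdg 4 4
          + U • wdg 4 5 + (-(U * Z / (2 * M))) • wdg 5 5 + M • wdg 5 6
          + (-Z) • wdg 5 7 + (-(M * Z / (2 * U))) • wdg 7 7)
        = (-M) • (wdg 1 2 + wdg 4 7 + (1/2 : ℂ) • wdg 5 5 + (1/2 : ℂ) • wdg 6 6) := by
  obtain ⟨t, ht⟩ := IsAlgClosed.exists_pow_nat_eq (Z / U) two_pos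
  have ht0 : t ≠ 0 := by
    rintro rfl
    exact div_ne_zero hZ hU (by rw [← ht]; simp)
  have hZ' : Z = t ^ 2 * U := by
    rw [ht]; field_simp
  have hst : t⁻¹ * t = 1 := inv_mul_cancel₀ ht0
  refine ⟨autA (Z / M) t⁻¹ t, autA_isEvenAut _ _ _ hst, ?_⟩
  rw [← autA_mapT M (Z / M) t⁻¹ t hst]
  have c1 : M * (Z / M) = Z := by field_simp
  have c2 : M * U / (2 * Z) = M * t⁻¹ ^ 2 / 2 := by rw [hZ']; field_simp
  have c3 : M * (Z / M) * t⁻¹ ^ 2 = U := by rw [hZ']; field_simp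
  have c4 : M * (Z / M) ^ 2 * t⁻¹ ^ 2 / 2 = U * Z / (2 * M) := by rw [hZ']; field_simp
  have c5 : M * t ^ 2 / 2 = M * Z / (2 * U) := by rw [hZ']; field_simp
  rw [c3, c4, c5, c1, c2]

end
end
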